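/- The set E is a closed subset of ℝ: if a sequence (θ_n) in E converges to θ ∈ ℝ, then θ ∈ E. -/

import Mathlib

open MeasureTheory Filter Set

structure HJSetting {Ω : Type} [MeasurableSpace Ω] (P : Measure Ω) (τ : ℝ → Ω → Ω)
    (a : ℝ → Ω → ℝ) (H : ℝ → ℝ → Ω → ℝ) (G_L G_U : ℝ → ℝ) : Prop where
  prob : IsProbabilityMeasure P
  meas_tau : Measurable fun q : ℝ × Ω => τ q.1 q.2
  mp_tau : ∀ x, MeasurePreserving (τ x) P P
  tau_zero : ∀ ω, τ 0 ω = ω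
  tau_add : ∀ x y ω, τ (x + y) ω = τ x (τ y ω)
  ergodic : ∀ A : Set Ω, MeasurableSet A → (∀ x, τ x ⁻¹' A = A) → P A = 0 ∨ P A = 1
  meas_a : Measurable fun q : ℝ × Ω => a q.1 q.2
  a_pos : ∀ x ω, 0 < a x ω
  a_le_one : ∀ x ω, a x ω ≤ 1
  a_stat : ∀ x ω, a x ω = a 0 (τ x ω)
  a_sqrt_lip : ∃ κ > (0:ℝ), ∀ x ω, |Real.sqrt (a x ω) - Real.sqrt (a 0 ω)| ≤ κ * |x|
  meas_H : Measurable fun q : ℝ × ℝ × Ω => H q.1 q.2.1 q.2.2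
  H_stat : ∀ p x ω, H p x ω = H p 0 (τ x ω)
  GL_cont : Continuous G_L
  GU_cont : Continuous G_U
  GL_even : ∀ p, G_L (-p) = G_L p
  GU_even : ∀ p, G_U (-p) = G_U p
  GL_mono : MonotoneOn G_L (Ici 0)
  GU_mono : MonotoneOn G_U (Ici 0)
  GL_coercive : Tendsto G_L atTop atTop
  GU_coercive : Tendsto G_U atTop atTop
  H_lower : ∀ p ω, G_L p ≤ H p 0 ω
  H_upper : ∀ p ω, H p 0 ω ≤ G_U p
  H_lip : ∀ R > (0:ℝ), ∃ K > (0:ℝ), ∀ p q ω, |p| ≤ R → |q| ≤ R →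
      |H p 0 ω - H q 0 ω| ≤ K * |p - q|
  H_mod : ∀ R > (0:ℝ), ∃ m : ℝ → ℝ, (∀ r, 0 ≤ m r) ∧ MonotoneOn m (Ici 0) ∧
      Tendsto m (nhdsWithin 0 (Ioi 0)) (nhds 0) ∧
      ∀ p x ω, |p| ≤ R → |H p x ω - H p 0 ω| ≤ m |x|

/-- `f` is a stationary solution of `a(x,ω) f' + H(f,x,ω) = lam`. -/
def StatSol {Ω : Type} [MeasurableSpace Ω] (P : Measure Ω) (τ : ℝ → Ω → Ω)
    (a : ℝ → Ω → ℝ) (H : ℝ → ℝ → Ω → ℝ) (lam : ℝ) (f : ℝ → Ω → ℝ) : Prop :=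
  (Measurable fun q : ℝ × Ω => f q.1 q.2) ∧
  (∀ x ω, f x ω = f 0 (τ x ω)) ∧
  (∀ ω, ContDiff ℝ 1 fun x => f x ω) ∧
  (∀ᵐ ω ∂P, (∃ M, ∀ x, |f x ω| ≤ M) ∧
    ∀ x, a x ω * deriv (fun y => f y ω) x + H (f x ω) x ω = lam)

/-- The set `E` of expectations `𝔼[f(0,·)]` over all stationary solutions `f`. -/
def Eset {Ω : Type} [MeasurableSpace Ω] (P : Measure Ω) (τ : ℝ → Ω → Ω)
    (a : ℝ → Ω → ℝ) (H : ℝ → ℝ → Ω → ℝ) : Set ℝ :=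
  {θ | ∃ lam f, StatSol P τ a H lam f ∧ (∫ ω, f 0 ω ∂P) = θ}

theorem pos_of_deriv_pos_of_eq_zero {g : ℝ → ℝ} (hg : Differentiable ℝ g)
    (h : ∀ x, g x = 0 → 0 < deriv g x) {x y : ℝ} (hxy : x < y) (hx : 0 ≤ g x) : 0 < g y := by
  have key : ∀ z ∈ Icc x y, -g z ≤ 0 := by
    intro z hz
    refine image_le_of_deriv_right_lt_deriv_boundary (f := fun z => -g z)
      (f' := fun z => -deriv g z) (B := fun _ => 0) (B' := fun _ => 0) (a := x) (b := y)
      hg.continuous.neg.continuousOn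
      (fun w _ => (hg w).hasDerivAt.neg.hasDerivWithinAt) (by simpa using hx)
      (fun w => hasDerivAt_const w (0 : ℝ)) (fun w _ hw => ?_) hz
    have := h w (by simpa using hw)
    simpa using this
  by_contra! hy
  have hy0 : g y = 0 := le_antisymm hy (by simpa using key y ⟨hxy.le, le_rfl⟩)
  have hev := (eventually_nhdsWithin_sign_eq_of_deriv_pos (h y hy0) hy0).filter_mono
    (nhdsWithin_le_nhds (s := Iio y))
  obtain ⟨z, hz, hxz, hzy⟩ := (hev.and (Ioo_mem_nhdsLT hxy)).exists
  rw [sign_neg (sub_neg.2 hzy), sign_eq_neg_one_iff] at hz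
  have := key z ⟨hxz.le, hzy.le⟩
  linarith

theorem le_of_deriv_le_neg_of_bounded {f : ℝ → ℝ} (hf : Differentiable ℝ f) {M c δ : ℝ}
    (hM : ∀ x, |f x| ≤ M) (hδ : 0 < δ) (h : ∀ x, c ≤ f x → deriv f x ≤ -δ) (x : ℝ) :
    f x ≤ c := by
  by_contra! hx
  have hlt : ∀ y < x, c < f y := by
    intro y hy
    by_contra! hyc
    have := pos_of_deriv_pos_of_eq_zero (g := fun z => c - f z) (by fun_prop)
      (fun z hz => by
        have := h z (by linarith)
        rw [deriv_const_sub]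
        linarith) hy (by linarith)
    linarith
  have hmem : ∀ y ∈ Iic x, c ≤ f y := fun y hy => by
    rcases eq_or_lt_of_le (show y ≤ x from hy) with rfl | h'
    exacts [hx.le, (hlt y h').le]
  have hM0 : 0 ≤ M := (abs_nonneg _).trans (hM x)
  have hpos : 0 < (2 * M + 1) / δ := by positivity
  have := (convex_Iic x).image_sub_le_mul_sub_of_deriv_le hf.continuous.continuousOn
    hf.differentiableOn (C := -δ) (fun y hy => h y (hmem y (interior_subset hy)))
    (x - (2 * M + 1) / δ) (by simp only [mem_Iic]; linarith) x (by simp) (by linarith)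
  have e : -δ * (x - (x - (2 * M + 1) / δ)) = -(2 * M + 1) := by field_simp; ring
  rw [e] at this
  have h1 := abs_le.1 (hM x)
  have h2 := abs_le.1 (hM (x - (2 * M + 1) / δ))
  linarith

/-- `f(·, ω)` is a bounded solution of `a f' + H(f, ·) = lam` along the sample path of `ω`. -/
def IsBoundedPathSol {Ω : Type} (a : ℝ → Ω → ℝ) (H : ℝ → ℝ → Ω → ℝ) (lam : ℝ)
    (f : ℝ → Ω → ℝ) (ω : Ω) : Prop :=
  (∃ M, ∀ x, |f x ω| ≤ M) ∧
    ∀ x, a x ω * deriv (fun y => f y ω) x + H (f x ω) x ω = lam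

theorem StatSol.differentiable {Ω : Type} [MeasurableSpace Ω] {P : Measure Ω} {τ : ℝ → Ω → Ω}
    {a : ℝ → Ω → ℝ} {H : ℝ → ℝ → Ω → ℝ} {lam : ℝ} {f : ℝ → Ω → ℝ} (hf : StatSol P τ a H lam f)
    (ω : Ω) : Differentiable ℝ fun x => f x ω :=
  (hf.2.2.1 ω).differentiable one_ne_zero

theorem StatSol.measurable_apply {Ω : Type} [MeasurableSpace Ω] {P : Measure Ω} {τ : ℝ → Ω → Ω}
    {a : ℝ → Ω → ℝ} {H : ℝ → ℝ → Ω → ℝ} {lam : ℝ} {f : ℝ → Ω → ℝ} (hf : StatSol P τ a H lam f)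
    (x : ℝ) : Measurable (f x) :=
  hf.1.comp (measurable_const.prodMk measurable_id)

namespace HJSetting

variable {Ω : Type} [MeasurableSpace Ω] {P : Measure Ω} {τ : ℝ → Ω → Ω}
  {a : ℝ → Ω → ℝ} {H : ℝ → ℝ → Ω → ℝ} {G_L G_U : ℝ → ℝ}

theorem continuous_a (hs : HJSetting P τ a H G_L G_U) (ω : Ω) : Continuous fun x => a x ω := by
  obtain ⟨κ, hκ, h⟩ := hs.a_sqrt_lip
  have hl : LipschitzWith κ.toNNReal fun x => Real.sqrt (a x ω) := by
    refine LipschitzWith.of_dist_le_mul fun x y => ?_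
    have := h (x - y) (τ y ω)
    rw [hs.a_stat (x - y), ← hs.tau_add, sub_add_cancel, ← hs.a_stat x, ← hs.a_stat y] at this
    rwa [Real.dist_eq, Real.dist_eq, Real.coe_toNNReal _ hκ.le]
  have : (fun x => a x ω) = fun x => Real.sqrt (a x ω) ^ 2 := by
    ext x
    rw [Real.sq_sqrt (hs.a_pos x ω).le]
  rw [this]
  exact hl.continuous.pow 2

theorem abs_H_sub_le (hs : HJSetting P τ a H G_L G_U) {R : ℝ} (hR : 0 < R) :
    ∃ K > (0 : ℝ), ∀ p q x ω, |p| ≤ R → |q| ≤ R → |H p x ω - H q x ω| ≤ K * |p - q| := by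
  obtain ⟨K, hK, h⟩ := hs.H_lip R hR
  refine ⟨K, hK, fun p q x ω hp hq => ?_⟩
  rw [hs.H_stat p, hs.H_stat q]
  exact h p q _ hp hq

theorem GL_abs (hs : HJSetting P τ a H G_L G_U) (p : ℝ) : G_L |p| = G_L p := by
  rcases abs_choice p with h | h <;> rw [h]
  exact hs.GL_even p

theorem GU_abs (hs : HJSetting P τ a H G_L G_U) (p : ℝ) : G_U |p| = G_U p := by
  rcases abs_choice p with h | h <;> rw [h]
  exact hs.GU_even p

theorem GL_le_H (hs : HJSetting P τ a H G_L G_U) (p x : ℝ) (ω : Ω) : G_L p ≤ H p x ω := by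
  rw [hs.H_stat]
  exact hs.H_lower _ _

theorem H_le_GU (hs : HJSetting P τ a H G_L G_U) (p x : ℝ) (ω : Ω) : H p x ω ≤ G_U p := by
  rw [hs.H_stat]
  exact hs.H_upper _ _

theorem abs_H_le (hs : HJSetting P τ a H G_L G_U) {p R : ℝ} (hp : |p| ≤ R) (x : ℝ) (ω : Ω) :
    |H p x ω| ≤ |G_L 0| + |G_U R| := by
  have h1 := hs.GL_mono (mem_Ici.2 le_rfl) (mem_Ici.2 (abs_nonneg p)) (abs_nonneg p)
  have h2 := hs.GU_mono (mem_Ici.2 (abs_nonneg p)) (mem_Ici.2 ((abs_nonneg p).trans hp)) hp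
  rw [hs.GL_abs] at h1
  rw [hs.GU_abs] at h2
  have h3 := hs.GL_le_H p x ω
  have h4 := hs.H_le_GU p x ω
  have h5 := neg_abs_le (G_L 0)
  have h6 := le_abs_self (G_U R)
  have h7 := abs_nonneg (G_L 0)
  have h8 := abs_nonneg (G_U R)
  rw [abs_le]
  constructor <;> linarith

theorem continuous_H_comp (hs : HJSetting P τ a H G_L G_U) {f : ℝ → ℝ} (hf : Continuous f)
    {R : ℝ} (hR : 0 < R) (hfR : ∀ x, |f x| ≤ R) (ω : Ω) : Continuous fun x => H (f x) x ω := by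
  obtain ⟨K, hK, hKl⟩ := hs.abs_H_sub_le hR
  obtain ⟨m, -, hmono, hlim, hm⟩ := hs.H_mod R hR
  rw [continuous_iff_continuousAt]
  intro y
  rw [Metric.continuousAt_iff]
  intro ε hε
  obtain ⟨r, hr0, hr⟩ : ∃ r > 0, m r < ε / 2 := by
    obtain ⟨r, hr, hr0⟩ := ((hlim.eventually (gt_mem_nhds (half_pos hε))).and
      self_mem_nhdsWithin).exists
    exact ⟨r, hr0, hr⟩
  obtain ⟨δ, hδ, hfδ⟩ := Metric.continuousAt_iff.1 (hf.continuousAt (x := y)) (ε / 2 / K)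
    (by positivity)
  refine ⟨min r δ, lt_min hr0 hδ, fun x hx => ?_⟩
  have hxr : |x - y| ≤ r := (hx.trans_le (min_le_left _ _)).le
  have h1 := hKl (f x) (f y) x ω (hfR x) (hfR y)
  have h2 : |H (f y) x ω - H (f y) y ω| ≤ m |x - y| := by
    have := hm (f y) (x - y) (τ y ω) (hfR y)
    rwa [hs.H_stat _ (x - y), ← hs.tau_add, sub_add_cancel, ← hs.H_stat _ x,
      ← hs.H_stat _ y] at this
  have h3 := hmono (mem_Ici.2 (abs_nonneg _)) (mem_Ici.2 hr0.le) hxr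
  have h4 : |f x - f y| < ε / 2 / K := hfδ (hx.trans_le (min_le_right _ _))
  rw [lt_div_iff₀ hK, mul_comm] at h4
  have h5 := abs_sub_le (H (f x) x ω) (H (f y) x ω) (H (f y) y ω)
  rw [Real.dist_eq]
  linarith

theorem deriv_eq (hs : HJSetting P τ a H G_L G_U) {lam : ℝ} {f : ℝ → Ω → ℝ} {ω : Ω}
    (hsol : IsBoundedPathSol a H lam f ω) (x : ℝ) :
    deriv (fun y => f y ω) x = (lam - H (f x ω) x ω) / a x ω := by
  rw [eq_div_iff (hs.a_pos x ω).ne', ← hsol.2 x]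
  ring

theorem abs_le_of_isBoundedPathSol (hs : HJSetting P τ a H G_L G_U) {lam c : ℝ} {f : ℝ → Ω → ℝ}
    {ω : Ω} (hd : Differentiable ℝ fun x => f x ω) (hsol : IsBoundedPathSol a H lam f ω)
    (hc : 0 ≤ c) (hlam : lam < G_L c) (x : ℝ) : |f x ω| ≤ c := by
  have hder : ∀ x, c ≤ |f x ω| → deriv (fun y => f y ω) x ≤ -(G_L c - lam) := by
    intro x hx
    have h1 := hs.GL_mono (mem_Ici.2 hc) (mem_Ici.2 (abs_nonneg (f x ω))) hx
    rw [hs.GL_abs] at h1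
    have h2 := hs.GL_le_H (f x ω) x ω
    have ha := hs.a_pos x ω
    rw [hs.deriv_eq hsol, div_le_iff₀ ha]
    nlinarith [hs.a_le_one x ω]
  obtain ⟨M, hM⟩ := hsol.1
  rw [abs_le]
  constructor
  · have := le_of_deriv_le_neg_of_bounded (f := fun z => -f (-z) ω) (M := M) (c := c)
      (δ := G_L c - lam) (hd.comp differentiable_neg).neg (fun z => by simpa using hM (-z))
      (by linarith) (fun z hz => by
        rw [deriv.fun_neg, deriv_comp_neg (f := fun y => f y ω), neg_neg]
        exact hder _ (hz.trans (neg_le_abs _))) (-x)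
    simp only [neg_neg] at this
    linarith
  · exact le_of_deriv_le_neg_of_bounded hd hM (by linarith)
      (fun z hz => hder z (hz.trans (le_abs_self _))) x

theorem eq_of_eq_at (hs : HJSetting P τ a H G_L G_U) {lam : ℝ} {f g : ℝ → Ω → ℝ} {ω : Ω}
    (hfd : Differentiable ℝ fun x => f x ω) (hgd : Differentiable ℝ fun x => g x ω)
    (hf : IsBoundedPathSol a H lam f ω) (hg : IsBoundedPathSol a H lam g ω) {t₀ : ℝ}
    (h0 : f t₀ ω = g t₀ ω) (t : ℝ) : f t ω = g t ω := by
  obtain ⟨M, hM⟩ := hf.1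
  obtain ⟨N, hN⟩ := hg.1
  set R := max (max M N) 1
  have hR : 0 < R := lt_of_lt_of_le one_pos (le_max_right _ _)
  obtain ⟨K, hK, hKl⟩ := hs.abs_H_sub_le hR
  obtain ⟨A, B, ht, ht₀⟩ : ∃ A B, t ∈ Ioo A B ∧ t₀ ∈ Ioo A B :=
    ⟨min t t₀ - 1, max t t₀ + 1, by grind, by grind⟩
  obtain ⟨z, -, hz⟩ := isCompact_Icc.exists_isMinOn (s := Icc A B) ⟨t, ht.1.le, ht.2.le⟩
    (hs.continuous_a ω).continuousOn
  have hz0 := hs.a_pos z ω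
  refine ODE_solution_unique_of_mem_Ioo (v := fun t p => (lam - H p t ω) / a t ω)
    (s := fun _ => {p | |p| ≤ R}) (K := (K / a z ω).toNNReal) (a := A) (b := B)
    (f := fun t => f t ω) (g := fun t => g t ω)
    (fun t ht => LipschitzOnWith.of_dist_le_mul fun p hp q hq => ?_) ht₀
    (fun t _ => ⟨?_, ?_⟩) (fun t _ => ⟨?_, ?_⟩) h0 ht
  · have hat := hs.a_pos t ω
    have hzt : a z ω ≤ a t ω := hz ⟨ht.1.le, ht.2.le⟩
    rw [Real.dist_eq, Real.dist_eq, Real.coe_toNNReal _ (by positivity), ← sub_div, abs_div,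
      abs_of_pos hat, div_mul_eq_mul_div,
      show lam - H p t ω - (lam - H q t ω) = -(H p t ω - H q t ω) by ring, abs_neg]
    exact div_le_div₀ (by positivity) (hKl p q t ω hp hq) hz0 hzt
  · rw [← hs.deriv_eq hf]
    exact (hfd t).hasDerivAt
  · exact (hM t).trans ((le_max_left _ _).trans (le_max_left _ _))
  · rw [← hs.deriv_eq hg]
    exact (hgd t).hasDerivAt
  · exact (hN t).trans ((le_max_right _ _).trans (le_max_left _ _))

theorem forall_nonneg_zero_one (hs : HJSetting P τ a H G_L G_U) {g : ℝ → Ω → ℝ}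
    (hgm : ∀ x, Measurable (g x)) (hst : ∀ x ω, g x ω = g 0 (τ x ω))
    (hgc : ∀ ω, Continuous fun x => g x ω) :
    (∀ᵐ ω ∂P, ∀ x, 0 ≤ g x ω) ∨ ∀ᵐ ω ∂P, ¬ ∀ x, 0 ≤ g x ω := by
  have := hs.prob
  have hA : MeasurableSet {ω | ∀ x, 0 ≤ g x ω} := by
    have : {ω | ∀ x, 0 ≤ g x ω} = ⋂ q : ℚ, {ω | 0 ≤ g q ω} := by
      ext ω
      simp only [mem_ofPred_eq, mem_iInter]
      refine ⟨fun h q => h q, fun h x => ?_⟩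
      exact (isClosed_le continuous_const (hgc ω)).closure_subset_iff.2
        (show range ((↑) : ℚ → ℝ) ⊆ {x | 0 ≤ g x ω} by rintro _ ⟨q, rfl⟩; exact h q)
        (Rat.denseRange_cast x)
    rw [this]
    exact MeasurableSet.iInter fun q => measurableSet_le measurable_const (hgm q)
  have hinv : ∀ y, τ y ⁻¹' {ω | ∀ x, 0 ≤ g x ω} = {ω | ∀ x, 0 ≤ g x ω} := by
    intro y
    ext ω
    have hsh : ∀ x, g x (τ y ω) = g (x + y) ω := fun x => by
      rw [hst x, hst (x + y), hs.tau_add]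
    simp only [mem_preimage, mem_ofPred_eq, hsh]
    exact ⟨fun h x => by simpa using h (x - y), fun h x => h _⟩
  rcases hs.ergodic _ hA hinv with h | h
  · right
    simpa [ae_iff] using h
  · left
    exact (prob_compl_eq_zero_iff hA).2 h

theorem ae_pos_or_ae_neg (hs : HJSetting P τ a H G_L G_U) {g : ℝ → Ω → ℝ}
    (hgm : ∀ x, Measurable (g x)) (hst : ∀ x ω, g x ω = g 0 (τ x ω))
    (hgd : ∀ ω, Differentiable ℝ fun x => g x ω)
    (hup : ∀ᵐ ω ∂P, ∀ x, g x ω = 0 → 0 < deriv (fun y => g y ω) x) :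
    (∀ᵐ ω ∂P, ∀ x, 0 < g x ω) ∨ ∀ᵐ ω ∂P, ∀ x, g x ω < 0 := by
  have := hs.prob
  rcases hs.forall_nonneg_zero_one hgm hst fun ω => (hgd ω).continuous with h | h
  · left
    filter_upwards [h, hup] with ω h1 h2 x
    exact pos_of_deriv_pos_of_eq_zero (hgd ω) h2 (sub_one_lt x) (h1 _)
  · right
    have hB : MeasurableSet {ω | 0 ≤ g 0 ω} := measurableSet_le measurable_const (hgm 0)
    have hsub : {ω | 0 ≤ g 0 ω} ≤ᵐ[P] τ 1 ⁻¹' {ω | 0 ≤ g 0 ω} := by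
      filter_upwards [hup] with ω h2 (h0 : 0 ≤ g 0 ω)
      change 0 ≤ g 0 (τ 1 ω)
      rw [← hst]
      exact (pos_of_deriv_pos_of_eq_zero (hgd ω) h2 one_pos h0).le
    have heq := ae_eq_of_ae_subset_of_measure_ge hsub
      ((hs.mp_tau 1).measure_preimage hB.nullMeasurableSet).le hB.nullMeasurableSet
      (measure_ne_top _ _)
    have hstep : ∀ᵐ ω ∂P, ∀ n : ℤ, 0 ≤ g n ω ↔ 0 ≤ g (n + 1) ω := by
      rw [ae_all_iff]
      intro n
      have := (hs.mp_tau n).quasiMeasurePreserving.ae heq.mem_iff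
      filter_upwards [this] with ω hω
      simp only [mem_preimage, mem_ofPred_eq] at hω
      rwa [← hs.tau_add, ← hst, ← hst, add_comm] at hω
    filter_upwards [h, hup, hstep] with ω h1 h2 h3 y
    have hall : ∀ n : ℤ, 0 ≤ g 0 ω ↔ 0 ≤ g n ω := by
      intro n
      induction n using Int.induction_on with
      | zero => simp
      | succ n ih =>
        rw [ih, h3]
        push_cast
        rfl
      | pred n ih =>
        rw [ih, ← sub_add_cancel (-(n : ℤ)) 1, Int.cast_add, Int.cast_one, ← h3]
        simp
    by_contra! hy
    refine h1 fun x => ?_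
    obtain ⟨n, hn⟩ := exists_int_gt y
    obtain ⟨m, hm⟩ := exists_int_lt x
    have hgn := pos_of_deriv_pos_of_eq_zero (hgd ω) h2 hn hy
    exact (pos_of_deriv_pos_of_eq_zero (hgd ω) h2 hm
      ((hall m).1 ((hall n).2 hgn.le))).le

theorem ae_le_or_ae_ge_of_lt (hs : HJSetting P τ a H G_L G_U) {lam mu : ℝ} {f g : ℝ → Ω → ℝ}
    (hf : StatSol P τ a H lam f) (hg : StatSol P τ a H mu g) (hlt : lam < mu) :
    (∀ᵐ ω ∂P, ∀ x, f x ω ≤ g x ω) ∨ ∀ᵐ ω ∂P, ∀ x, g x ω ≤ f x ω := by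
  have hfd := hf.differentiable
  have hgd := hg.differentiable
  refine (hs.ae_pos_or_ae_neg (g := fun x ω => g x ω - f x ω)
    (fun x => (hg.measurable_apply x).sub (hf.measurable_apply x))
    (fun x ω => by rw [← hf.2.1, ← hg.2.1]) (fun ω => (hgd ω).sub (hfd ω)) ?_).imp ?_ ?_
  · filter_upwards [hf.2.2.2, hg.2.2.2] with ω h1 h2 x hx
    rw [deriv_fun_sub (hgd ω x) (hfd ω x), hs.deriv_eq h1, hs.deriv_eq h2, sub_eq_zero.1 hx,
      ← sub_div]
    exact div_pos (by linarith) (hs.a_pos x ω)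
  · exact fun h => h.mono fun ω h x => (sub_pos.1 (h x)).le
  · exact fun h => h.mono fun ω h x => (sub_neg.1 (h x)).le

theorem ae_le_or_ae_ge (hs : HJSetting P τ a H G_L G_U) {lam mu : ℝ} {f g : ℝ → Ω → ℝ}
    (hf : StatSol P τ a H lam f) (hg : StatSol P τ a H mu g) :
    (∀ᵐ ω ∂P, ∀ x, f x ω ≤ g x ω) ∨ ∀ᵐ ω ∂P, ∀ x, g x ω ≤ f x ω := by
  rcases lt_trichotomy lam mu with h | rfl | h
  · exact hs.ae_le_or_ae_ge_of_lt hf hg h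
  · have hfd := hf.differentiable
    have hgd := hg.differentiable
    refine (hs.forall_nonneg_zero_one (g := fun x ω => g x ω - f x ω)
      (fun x => (hg.measurable_apply x).sub (hf.measurable_apply x))
      (fun x ω => by rw [← hf.2.1, ← hg.2.1])
      (fun ω => ((hgd ω).sub (hfd ω)).continuous)).imp
      (fun h => h.mono fun ω h x => sub_nonneg.1 (h x)) fun h => ?_
    filter_upwards [h, hf.2.2.2, hg.2.2.2] with ω h1 h2 h3 x
    by_contra! hx
    refine h1 fun y => ?_
    by_contra! hy
    obtain ⟨z, hz⟩ : (0 : ℝ) ∈ range fun z => g z ω - f z ω :=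
      mem_range_of_exists_le_of_exists_ge ((hgd ω).sub (hfd ω)).continuous ⟨y, hy.le⟩
        ⟨x, (sub_pos.2 hx).le⟩
    exact hx.ne (hs.eq_of_eq_at (hfd ω) (hgd ω) h2 h3 (sub_eq_zero.1 hz).symm x)
  · exact (hs.ae_le_or_ae_ge_of_lt hg hf h).symm

theorem exists_ae_abs_le (hs : HJSetting P τ a H G_L G_U) (L : ℝ) :
    ∃ R > (0 : ℝ), ∀ lam f, StatSol P τ a H lam f → lam ≤ L →
      ∀ᵐ ω ∂P, ∀ x, |f x ω| ≤ R := by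
  obtain ⟨R, hR, hR0⟩ := ((hs.GL_coercive.eventually_gt_atTop L).and
    (eventually_gt_atTop 0)).exists
  refine ⟨R, hR0, fun lam f hf hlam => ?_⟩
  filter_upwards [hf.2.2.2] with ω hω
  exact hs.abs_le_of_isBoundedPathSol (hf.differentiable ω) hω hR0.le (hlam.trans_lt hR)

theorem integrable_zero (hs : HJSetting P τ a H G_L G_U) {lam : ℝ} {f : ℝ → Ω → ℝ}
    (hf : StatSol P τ a H lam f) : Integrable (f 0) P := by
  have := hs.prob
  obtain ⟨R, -, h⟩ := hs.exists_ae_abs_le lam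
  exact Integrable.of_bound (hf.measurable_apply 0).aestronglyMeasurable R
    ((h lam f hf le_rfl).mono fun ω hω => hω 0)

theorem integral_ne_of_upcrossing (hs : HJSetting P τ a H G_L G_U) {g : ℝ → Ω → ℝ}
    (hgm : ∀ x, Measurable (g x)) (hst : ∀ x ω, g x ω = g 0 (τ x ω))
    (hgd : ∀ ω, Differentiable ℝ fun x => g x ω) (hint : Integrable (g 0) P)
    (hup : ∀ᵐ ω ∂P, ∀ x, g x ω = 0 → 0 < deriv (fun y => g y ω) x) :
    ∫ ω, g 0 ω ∂P ≠ 0 := by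
  have := hs.prob
  intro h0
  rcases hs.ae_pos_or_ae_neg hgm hst hgd hup with h | h
  · have h1 := (integral_eq_zero_iff_of_nonneg_ae
      (h.mono fun ω hω => (hω 0).le) hint).1 h0
    obtain ⟨ω, h2, h3⟩ := (h.and h1).exists
    exact (h2 0).ne' h3
  · have h1 := (integral_eq_zero_iff_of_nonneg_ae (f := fun ω => -g 0 ω)
      (h.mono fun ω hω => (neg_pos.2 (hω 0)).le) hint.neg).1 (by rw [integral_neg, h0, neg_zero])
    obtain ⟨ω, h2, h3⟩ := (h.and h1).exists
    exact (h2 0).ne (neg_eq_zero.1 h3)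

theorem lam_mem_Icc (hs : HJSetting P τ a H G_L G_U) {lam : ℝ} {f : ℝ → Ω → ℝ}
    (hf : StatSol P τ a H lam f) :
    lam ∈ Icc (G_L (∫ ω, f 0 ω ∂P)) (G_U (∫ ω, f 0 ω ∂P)) := by
  have := hs.prob
  have hfd := hf.differentiable
  set θ := ∫ ω, f 0 ω ∂P with hθ
  have hint := hs.integrable_zero hf
  constructor <;> by_contra! hlt
  · refine hs.integral_ne_of_upcrossing (g := fun x ω => θ - f x ω)
      (fun x => (hf.measurable_apply x).const_sub θ) (fun x ω => by rw [← hf.2.1])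
      (fun ω => (hfd ω).const_sub θ) ((integrable_const θ).sub hint) ?_ ?_
    · filter_upwards [hf.2.2.2] with ω h1 x hx
      rw [deriv_const_sub, hs.deriv_eq h1, ← neg_div, ← sub_eq_zero.1 hx]
      exact div_pos (by linarith [hs.GL_le_H θ x ω]) (hs.a_pos x ω)
    · rw [integral_sub (integrable_const θ) hint]
      simp [← hθ]
  · refine hs.integral_ne_of_upcrossing (g := fun x ω => f x ω - θ)
      (fun x => (hf.measurable_apply x).sub_const θ) (fun x ω => by rw [← hf.2.1])
      (fun ω => (hfd ω).sub_const θ) (hint.sub (integrable_const θ)) ?_ ?_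
    · filter_upwards [hf.2.2.2] with ω h1 x hx
      rw [deriv_sub_const, hs.deriv_eq h1, sub_eq_zero.1 hx]
      exact div_pos (by linarith [hs.H_le_GU θ x ω]) (hs.a_pos x ω)
    · rw [integral_sub hint (integrable_const θ)]
      simp [← hθ]

theorem exists_invariant_measurableSet (hs : HJSetting P τ a H G_L G_U) {p : Ω → Prop}
    (hp : ∀ᵐ ω ∂P, p ω) (hinv : ∀ x ω, p (τ x ω) → p ω) :
    ∃ S : Set Ω, MeasurableSet S ∧ (∀ x ω, τ x ω ∈ S ↔ ω ∈ S) ∧ (∀ᵐ ω ∂P, ω ∈ S) ∧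
      ∀ ω ∈ S, p ω := by
  have := hs.prob
  obtain ⟨N, hpN, hN, hN0⟩ := exists_measurable_superset_of_null (ae_iff.1 hp)
  have hT : MeasurableSet {q : Ω × ℝ | τ q.2 q.1 ∈ N} :=
    (hs.meas_tau.comp measurable_swap) hN
  refine ⟨{ω | volume {x | τ x ω ∈ N} = 0},
    measurable_measure_prodMk_left hT (measurableSet_singleton 0), fun y ω => ?_, ?_, ?_⟩
  · have : {x | τ x (τ y ω) ∈ N} = (fun x => x + y) ⁻¹' {x | τ x ω ∈ N} := by
      ext x
      simp [hs.tau_add]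
    simp only [mem_ofPred_eq, this, measure_preimage_add_right]
  · have h1 : ∀ᵐ x ∂(volume : Measure ℝ), ∀ᵐ ω ∂P, τ x ω ∉ N := ae_of_all _ fun x =>
      (hs.mp_tau x).quasiMeasurePreserving.ae (measure_eq_zero_iff_ae_notMem.1 hN0)
    rw [Measure.ae_ae_comm (p := fun x ω => τ x ω ∉ N) (hs.meas_tau hN.compl)] at h1
    filter_upwards [h1] with ω hω
    simpa [ae_iff] using hω
  · intro ω hω
    have : ∀ᵐ x ∂(volume : Measure ℝ), τ x ω ∉ N := measure_eq_zero_iff_ae_notMem.1 hω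
    obtain ⟨x, hx⟩ := this.exists
    exact hinv x ω (by_contra fun h => hx (hpN h))

theorem isBoundedPathSol_of_tau (hs : HJSetting P τ a H G_L G_U) {lam : ℝ} {f : ℝ → Ω → ℝ}
    (hst : ∀ x ω, f x ω = f 0 (τ x ω)) {y : ℝ} {ω : Ω}
    (h : IsBoundedPathSol a H lam f (τ y ω)) : IsBoundedPathSol a H lam f ω := by
  have hsh : ∀ x, f x (τ y ω) = f (x + y) ω := fun x => by
    rw [hst x, hst (x + y), hs.tau_add]
  obtain ⟨⟨M, hM⟩, hsol⟩ := h
  refine ⟨⟨M, fun x => ?_⟩, fun x => ?_⟩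
  · simpa [hsh] using hM (x - y)
  · have := hsol (x - y)
    simp only [hsh] at this
    rwa [deriv_comp_add_const (f := fun z => f z ω), sub_add_cancel, hs.a_stat, hs.H_stat,
      ← hs.tau_add, sub_add_cancel, ← hs.a_stat, ← hs.H_stat] at this

theorem isBoundedPathSol_of_tendsto (hs : HJSetting P τ a H G_L G_U) {lam : ℕ → ℝ} {mu L R : ℝ}
    {f : ℕ → ℝ → Ω → ℝ} {g : ℝ → Ω → ℝ} {ω : Ω} (hR : 0 < R)
    (hd : ∀ n, Differentiable ℝ fun x => f n x ω)
    (hsol : ∀ n, IsBoundedPathSol a H (lam n) (f n) ω) (hfR : ∀ n x, |f n x ω| ≤ R)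
    (hL : ∀ n, |lam n| ≤ L) (hlam : Tendsto lam atTop (nhds mu))
    (hlim : ∀ x, Tendsto (fun n => f n x ω) atTop (nhds (g x ω))) :
    (ContDiff ℝ 1 fun x => g x ω) ∧ IsBoundedPathSol a H mu g ω := by
  have hgR : ∀ x, |g x ω| ≤ R := fun x =>
    le_of_tendsto (hlim x).abs (Eventually.of_forall fun n => hfR n x)
  obtain ⟨K, hK, hKl⟩ := hs.abs_H_sub_le hR
  have hac := hs.continuous_a ω
  have ha0 : ∀ x, a x ω ≠ 0 := fun x => (hs.a_pos x ω).ne'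
  set b : ℝ → ℝ := fun x => (L + (|G_L 0| + |G_U R|)) / a x ω
  have hb : Continuous b := continuous_const.div hac ha0
  set F : ℕ → ℝ → ℝ := fun n x => (lam n - H (f n x ω) x ω) / a x ω with hF
  set G : ℝ → ℝ := fun x => (mu - H (g x ω) x ω) / a x ω with hG
  have hFc : ∀ n, Continuous (F n) := fun n =>
    (continuous_const.sub (hs.continuous_H_comp (hd n).continuous hR (hfR n) ω)).div hac ha0
  have hFG : ∀ x, Tendsto (fun n => F n x) atTop (nhds (G x)) := by
    intro x
    refine (hlam.sub ?_).div_const _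
    rw [tendsto_iff_dist_tendsto_zero]
    have h1 : Tendsto (fun n => K * |f n x ω - g x ω|) atTop (nhds 0) := by
      simpa using ((hlim x).sub_const (g x ω)).abs.const_mul K
    exact squeeze_zero (fun _ => dist_nonneg)
      (fun n => hKl _ _ x ω (hfR n x) (hgR x)) h1
  have hFb : ∀ n x, ‖F n x‖ ≤ b x := fun n x => by
    rw [Real.norm_eq_abs, abs_div, abs_of_pos (hs.a_pos x ω)]
    exact div_le_div_of_nonneg_right
      ((abs_sub _ _).trans (add_le_add (hL n) (hs.abs_H_le (hfR n x) x ω))) (hs.a_pos x ω).le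
  have hGb : ∀ x, ‖G x‖ ≤ b x := fun x =>
    le_of_tendsto (hFG x).norm (Eventually.of_forall fun n => hFb n x)
  have hGm : Measurable G := measurable_of_tendsto_metrizable (fun n => (hFc n).measurable)
    (tendsto_pi_nhds.2 hFG)
  have hGi : ∀ x y, IntervalIntegrable G volume x y := fun x y =>
    (hb.intervalIntegrable x y).mono_fun hGm.aestronglyMeasurable
      (ae_of_all _ fun z => (hGb z).trans (le_abs_self _))
  have hint : ∀ x, g x ω = g 0 ω + ∫ y in (0 : ℝ)..x, G y := by
    intro x
    have h1 : ∀ n, ∫ y in (0 : ℝ)..x, F n y = f n x ω - f n 0 ω := fun n =>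
      intervalIntegral.integral_eq_sub_of_hasDerivAt (f := fun x => f n x ω)
        (fun y _ => by
          simp only [hF]
          rw [← hs.deriv_eq (hsol n)]
          exact (hd n y).hasDerivAt)
        ((hFc n).intervalIntegrable 0 x)
    have h2 : Tendsto (fun n => ∫ y in (0 : ℝ)..x, F n y) atTop
        (nhds (∫ y in (0 : ℝ)..x, G y)) :=
      intervalIntegral.tendsto_integral_filter_of_dominated_convergence b
        (Eventually.of_forall fun n => (hFc n).aestronglyMeasurable)
        (Eventually.of_forall fun n => ae_of_all _ fun y _ => hFb n y)
        (hb.intervalIntegrable 0 x) (ae_of_all _ fun y _ => hFG y)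
    simp only [h1] at h2
    rw [tendsto_nhds_unique h2 ((hlim x).sub (hlim 0))]
    ring
  have hgc : Continuous fun x => g x ω := by
    rw [funext hint]
    exact continuous_const.add (intervalIntegral.continuous_primitive hGi 0)
  have hGc : Continuous G :=
    (continuous_const.sub (hs.continuous_H_comp hgc hR hgR ω)).div hac ha0
  have hder : ∀ x, HasDerivAt (fun x => g x ω) (G x) x := by
    intro x
    rw [funext hint]
    exact (intervalIntegral.integral_hasDerivAt_right (hGi 0 x)
      (hGc.stronglyMeasurableAtFilter _ _) hGc.continuousAt).const_add _
  refine ⟨contDiff_one_iff_deriv.2 ⟨fun x => (hder x).differentiableAt, ?_⟩, ⟨R, hgR⟩,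
    fun x => ?_⟩
  · rwa [funext fun x => (hder x).deriv]
  · rw [(hder x).deriv, hG, mul_div_cancel₀ _ (ha0 x)]
    ring

/-- A sequence of stationary solutions with convergent values of `lam` and uniformly bounded,
almost surely convergent paths has a stationary limit, whose mean is the limit of the means. -/
theorem mem_Eset_of_tendsto (hs : HJSetting P τ a H G_L G_U) {lam : ℕ → ℝ} {mu L R θ : ℝ}
    {f : ℕ → ℝ → Ω → ℝ} (hR : 0 < R) (hf : ∀ n, StatSol P τ a H (lam n) (f n))
    (hL : ∀ n, |lam n| ≤ L) (hlam : Tendsto lam atTop (nhds mu))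
    (hfR : ∀ᵐ ω ∂P, ∀ n x, |f n x ω| ≤ R)
    (hlim : ∀ᵐ ω ∂P, ∀ x, ∃ l, Tendsto (fun n => f n x ω) atTop (nhds l))
    (hθ : Tendsto (fun n => ∫ ω, f n 0 ω ∂P) atTop (nhds θ)) : θ ∈ Eset P τ a H := by
  have := hs.prob
  have hsh : ∀ n x y ω, f n x (τ y ω) = f n (x + y) ω := fun n x y ω => by
    rw [(hf n).2.1 x, (hf n).2.1 (x + y), hs.tau_add]
  obtain ⟨S, hSm, hSinv, hSae, hSp⟩ := hs.exists_invariant_measurableSet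
    (p := fun ω => (∀ n, IsBoundedPathSol a H (lam n) (f n) ω) ∧ (∀ n x, |f n x ω| ≤ R) ∧
      ∀ x, ∃ l, Tendsto (fun n => f n x ω) atTop (nhds l))
    (by
      filter_upwards [ae_all_iff.2 fun n => (hf n).2.2.2, hfR, hlim] with ω h1 h2 h3
      exact ⟨h1, h2, h3⟩)
    (by
      rintro y ω ⟨h1, h2, h3⟩
      refine ⟨fun n => hs.isBoundedPathSol_of_tau (hf n).2.1 (h1 n), fun n x => ?_, fun x => ?_⟩
      · simpa [hsh] using h2 n (x - y)
      · simpa [hsh] using h3 (x - y))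
  have hex : ∀ ω, ∃ l, Tendsto (fun n => S.indicator (f n 0) ω) atTop (nhds l) := by
    intro ω
    by_cases hω : ω ∈ S
    · simpa [hω] using (hSp ω hω).2.2 0
    · exact ⟨0, by simp [hω]⟩
  choose g₀ hg₀ using hex
  have hg₀m : Measurable g₀ := measurable_of_tendsto_metrizable
    (fun n => ((hf n).measurable_apply 0).indicator hSm) (tendsto_pi_nhds.2 hg₀)
  have hg_lim : ∀ ω ∈ S, ∀ x, Tendsto (fun n => f n x ω) atTop (nhds (g₀ (τ x ω))) := by
    intro ω hω x
    have := hg₀ (τ x ω)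
    simpa [(hSinv x ω).2 hω, hsh] using this
  have hsol : ∀ ω ∈ S, (ContDiff ℝ 1 fun x => g₀ (τ x ω)) ∧
      IsBoundedPathSol a H mu (fun x ω => g₀ (τ x ω)) ω := fun ω hω =>
    hs.isBoundedPathSol_of_tendsto (g := fun x ω => g₀ (τ x ω)) hR
      (fun n => (hf n).differentiable ω) (hSp ω hω).1 (hSp ω hω).2.1 hL hlam (hg_lim ω hω)
  refine ⟨mu, fun x ω => g₀ (τ x ω), ⟨hg₀m.comp hs.meas_tau, fun x ω => ?_, fun ω => ?_,
    hSae.mono fun ω hω => (hsol ω hω).2⟩, ?_⟩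
  · simp only [hs.tau_zero]
  · by_cases hω : ω ∈ S
    · exact (hsol ω hω).1
    · have : ∀ x, g₀ (τ x ω) = 0 := fun x => by
        have h := hg₀ (τ x ω)
        have hx : τ x ω ∉ S := fun h => hω ((hSinv x ω).1 h)
        simp only [indicator_of_notMem hx] at h
        exact (tendsto_nhds_unique h tendsto_const_nhds)
      simp only [this]
      exact contDiff_const
  · refine tendsto_nhds_unique (tendsto_integral_of_dominated_convergence (fun _ => R)
      (fun n => ((hf n).measurable_apply 0).aestronglyMeasurable) (integrable_const R)
      (fun n => hfR.mono fun ω h => h n 0) ?_) hθ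
    exact hSae.mono fun ω hω => hg_lim ω hω 0

end HJSetting

theorem Eset_isClosed
    {Ω : Type} [MeasurableSpace Ω] (P : Measure Ω) (τ : ℝ → Ω → Ω)
    (a : ℝ → Ω → ℝ) (H : ℝ → ℝ → Ω → ℝ) (G_L G_U : ℝ → ℝ)
    (hset : HJSetting P τ a H G_L G_U)
 :
    IsClosed (Eset P τ a H) := by
  refine IsSeqClosed.isClosed fun u θ hu hθ => ?_
  choose lam f hf hfu using hu
  have hbdd : Bornology.IsBounded (range lam) := by
    have hGL : Bornology.IsBounded (range fun n => G_L (u n)) :=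
      Metric.isBounded_range_of_tendsto _ ((hset.GL_cont.tendsto θ).comp hθ)
    have hGU : Bornology.IsBounded (range fun n => G_U (u n)) :=
      Metric.isBounded_range_of_tendsto _ ((hset.GU_cont.tendsto θ).comp hθ)
    obtain ⟨A, hA⟩ := hGL.bddBelow
    obtain ⟨B, hB⟩ := hGU.bddAbove
    refine (Metric.isBounded_Icc A B).subset ?_
    rintro _ ⟨n, rfl⟩
    have h := hset.lam_mem_Icc (hf n)
    rw [hfu] at h
    exact ⟨(hA ⟨n, rfl⟩).trans h.1, h.2.trans (hB ⟨n, rfl⟩)⟩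
  obtain ⟨L, hL⟩ := hbdd.exists_norm_le
  obtain ⟨mu, -, φ, hφ, hmu⟩ := tendsto_subseq_of_bounded hbdd fun n => mem_range_self n
  obtain ⟨R, hR, hfR⟩ := hset.exists_ae_abs_le L
  have hfR' : ∀ᵐ ω ∂P, ∀ n x, |f n x ω| ≤ R := ae_all_iff.2 fun n =>
    hfR _ _ (hf n) ((le_abs_self _).trans (hL _ ⟨n, rfl⟩))
  let r : (ℝ → Ω → ℝ) → (ℝ → Ω → ℝ) → Prop := fun f g => ∀ᵐ ω ∂P, ∀ x, f x ω ≤ g x ω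
  have : IsTrans _ r := ⟨fun f g h hfg hgh => by
    filter_upwards [hfg, hgh] with ω h1 h2 x
    exact (h1 x).trans (h2 x)⟩
  obtain ⟨ψ, hψ⟩ := exists_increasing_or_nonincreasing_subseq r fun n => f (φ n)
  refine hset.mem_Eset_of_tendsto (lam := fun n => lam (φ (ψ n))) (f := fun n => f (φ (ψ n)))
    hR (fun n => hf _) (fun n => hL _ ⟨_, rfl⟩) (hmu.comp ψ.strictMono.tendsto_atTop)
    (hfR'.mono fun ω h n => h _) ?_ ?_
  · rcases hψ with h | h
    · have h' : ∀ᵐ ω ∂P, ∀ n x, f (φ (ψ n)) x ω ≤ f (φ (ψ (n + 1))) x ω :=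
        ae_all_iff.2 fun n => h n (n + 1) n.lt_succ_self
      filter_upwards [h', hfR'] with ω h1 h2 x
      exact ⟨_, tendsto_atTop_ciSup (monotone_nat_of_le_succ fun n => h1 n x)
        ⟨R, by rintro _ ⟨n, rfl⟩; exact (abs_le.1 (h2 _ x)).2⟩⟩
    · have h' : ∀ᵐ ω ∂P, ∀ n x, f (φ (ψ (n + 1))) x ω ≤ f (φ (ψ n)) x ω :=
        ae_all_iff.2 fun n => (hset.ae_le_or_ae_ge (hf _) (hf _)).resolve_left
          (h n (n + 1) n.lt_succ_self)
      filter_upwards [h', hfR'] with ω h1 h2 x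
      exact ⟨_, tendsto_atTop_ciInf (antitone_nat_of_succ_le fun n => h1 n x)
        ⟨-R, by rintro _ ⟨n, rfl⟩; exact (abs_le.1 (h2 _ x)).1⟩⟩
  · simp only [hfu]
    exact hθ.comp (hφ.tendsto_atTop.comp ψ.strictMono.tendsto_atTop)
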